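/- Let β > 3, let k = 3/(3−β) (note k < 0), and let f₋₋(x,y,z) = β(x²y²+y²z²+z²x²) − (x²+y²+z²+1/2)² + (1−k)/4. Then the set of singular points of the quartic Q⁻⁻(k) = {f₋₋ = 0}, that is, the set of points at which f₋₋ and all three of its partial derivatives vanish, is exactly the set of eight points (ε₁s, ε₂s, ε₃s) with ε₁, ε₂, ε₃ ∈ {−1,1} and s = 1/√(2(β−3)) (the vertices of a cube centered at the origin). -/

import Mathlib

/-- The quartic polynomial `β·v - (u + 1/2)² + (1-k)/4` defining `Q⁻⁻(k)`. -/
noncomputable def fMM (β k : ℝ) (p : EuclideanSpace ℝ (Fin 3)) : ℝ :=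
  β * ((p 0)^2*(p 1)^2 + (p 1)^2*(p 2)^2 + (p 2)^2*(p 0)^2)
    - ((p 0)^2 + (p 1)^2 + (p 2)^2 + 1/2)^2 + (1 - k)/4

theorem hasFDerivAt_fMM (β k : ℝ) (p : EuclideanSpace ℝ (Fin 3)) :
    HasFDerivAt (fMM β k)
      (∑ i, (2 * p i * (β * ((p 0)^2 + (p 1)^2 + (p 2)^2 - (p i)^2)
          - (2 * ((p 0)^2 + (p 1)^2 + (p 2)^2) + 1))) •
        (EuclideanSpace.proj i : EuclideanSpace ℝ (Fin 3) →L[ℝ] ℝ)) p := by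
  have h (i : Fin 3) : HasFDerivAt (fun q : EuclideanSpace ℝ (Fin 3) => (q i)^2)
      ((2 * p i) • (EuclideanSpace.proj i : EuclideanSpace ℝ (Fin 3) →L[ℝ] ℝ)) p := by
    have := (EuclideanSpace.proj i : EuclideanSpace ℝ (Fin 3) →L[ℝ] ℝ).hasFDerivAt (x := p)
    simpa using this.pow 2
  have hu := (((h 0).add (h 1)).add (h 2)).add_const (1/2 : ℝ)
  have hv := (((h 0).mul (h 1)).add ((h 1).mul (h 2))).add ((h 2).mul (h 0))
  refine (((hv.const_mul β).sub (hu.pow 2)).add_const ((1 - k)/4)).congr_fderiv ?_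
  ext w
  simp [Fin.sum_univ_three]
  ring

theorem fderiv_fMM_eq_zero_iff (β k : ℝ) (p : EuclideanSpace ℝ (Fin 3)) :
    fderiv ℝ (fMM β k) p = 0 ↔
      ∀ i, p i = 0 ∨ β * ((p 0)^2 + (p 1)^2 + (p 2)^2 - (p i)^2)
          = 2 * ((p 0)^2 + (p 1)^2 + (p 2)^2) + 1 := by
  rw [(hasFDerivAt_fMM β k p).fderiv]
  constructor
  · intro h i
    have hi := congrArg (fun L => L (EuclideanSpace.single i 1)) h
    simpa [Pi.single_apply, sub_eq_zero] using hi
  · intro h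
    refine Finset.sum_eq_zero fun i _ => ?_
    rcases h i with h | h <;> simp [h]

/-- A singular point has no vanishing coordinate. -/
theorem ne_zero_of_singular {β x y z : ℝ} (hβ : 3 < β)
    (hk : -2 * (x^2 + y^2 + z^2) * (3 - β) = 3)
    (hx : x = 0 ∨ β * (x^2 + y^2 + z^2 - x^2) = 2 * (x^2 + y^2 + z^2) + 1)
    (hy : y = 0 ∨ β * (x^2 + y^2 + z^2 - y^2) = 2 * (x^2 + y^2 + z^2) + 1) : z ≠ 0 := by
  rintro rfl
  rcases eq_or_ne x 0 with rfl | hx0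
  · rcases hy with rfl | hy
    · norm_num at hk
    · nlinarith [sq_nonneg y]
  rcases eq_or_ne y 0 with rfl | hy0
  · have := hx.resolve_left hx0
    nlinarith [sq_nonneg x]
  have h1 := hx.resolve_left hx0
  have h2 := hy.resolve_left hy0
  have h3 : x^2 = y^2 := mul_left_cancel₀ (by linarith : β ≠ 0) (by linarith)
  have : β * y^2 = 0 := by
    rw [h3] at h1 hk
    nlinarith
  have : 0 < β * y^2 := by positivity
  linarith

/-- The system satisfied by the squared coordinates of a singular point has a unique solution. -/
theorem sq_eq_of_singular {β x y z : ℝ} (hβ : 3 < β)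
    (hf : β * (x^2*y^2 + y^2*z^2 + z^2*x^2) - (x^2 + y^2 + z^2 + 1/2)^2
      + (1 - 3/(3-β))/4 = 0)
    (hx : x = 0 ∨ β * (x^2 + y^2 + z^2 - x^2) = 2 * (x^2 + y^2 + z^2) + 1)
    (hy : y = 0 ∨ β * (x^2 + y^2 + z^2 - y^2) = 2 * (x^2 + y^2 + z^2) + 1)
    (hz : z = 0 ∨ β * (x^2 + y^2 + z^2 - z^2) = 2 * (x^2 + y^2 + z^2) + 1) :
    2 * (β - 3) * x^2 = 1 ∧ 2 * (β - 3) * y^2 = 1 ∧ 2 * (β - 3) * z^2 = 1 := by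
  have hk : 3/(3-β) * (3-β) = 3 := div_mul_cancel₀ _ (by linarith)
  generalize 3/(3-β) = k at hf hk
  have ex : x^2 * (β * (x^2 + y^2 + z^2 - x^2) - (2 * (x^2 + y^2 + z^2) + 1)) = 0 := by
    rcases hx with h | h
    · simp [h]
    · rw [h, sub_self, mul_zero]
  have ey : y^2 * (β * (x^2 + y^2 + z^2 - y^2) - (2 * (x^2 + y^2 + z^2) + 1)) = 0 := by
    rcases hy with h | h
    · simp [h]
    · rw [h, sub_self, mul_zero]
  have ez : z^2 * (β * (x^2 + y^2 + z^2 - z^2) - (2 * (x^2 + y^2 + z^2) + 1)) = 0 := by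
    rcases hz with h | h
    · simp [h]
    · rw [h, sub_self, mul_zero]
  have hu : k = -2 * (x^2 + y^2 + z^2) := by linear_combination (-4) * hf + 2 * (ex + ey + ez)
  subst hu
  have hβ0 : β ≠ 0 := by linarith
  have h0 : x ≠ 0 ∧ y ≠ 0 ∧ z ≠ 0 := by
    refine ⟨ne_zero_of_singular (x := y) (y := z) hβ ?_ ?_ ?_,
      ne_zero_of_singular (x := z) (y := x) hβ ?_ ?_ ?_,
      ne_zero_of_singular (x := x) (y := y) hβ ?_ ?_ ?_⟩
    all_goals grind
  obtain ⟨h1, h2, h3⟩ := h0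
  replace hx := hx.resolve_left h1
  replace hy := hy.resolve_left h2
  replace hz := hz.resolve_left h3
  have hxy : x^2 = y^2 := mul_left_cancel₀ hβ0 (by linarith)
  have hyz : y^2 = z^2 := mul_left_cancel₀ hβ0 (by linarith)
  refine ⟨?_, ?_, ?_⟩ <;> grind

/-- for `β > 3` and `k = 3/(3-β)`, the singular points of `Q⁻⁻(k)` are
the eight points `(±s, ±s, ±s)` with `s = 1/√(2(β-3))` (vertices of a cube). -/
theorem stmt_19 (β : ℝ) (hβ : 3 < β) (k : ℝ) (hk : k = 3/(3-β)) :
    {p : EuclideanSpace ℝ (Fin 3) |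
        fMM β k p = 0 ∧ fderiv ℝ (fMM β k) p = 0} =
      {p : EuclideanSpace ℝ (Fin 3) | ∃ ε₁ ε₂ ε₃ : ℝ,
        (ε₁ = 1 ∨ ε₁ = -1) ∧ (ε₂ = 1 ∨ ε₂ = -1) ∧ (ε₃ = 1 ∨ ε₃ = -1) ∧
        p 0 = ε₁ * (1 / Real.sqrt (2*(β-3))) ∧
        p 1 = ε₂ * (1 / Real.sqrt (2*(β-3))) ∧
        p 2 = ε₃ * (1 / Real.sqrt (2*(β-3)))} := by
  subst hk
  have hpos : 0 < 2 * (β - 3) := by linarith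
  have hsq : (1 / Real.sqrt (2 * (β - 3)))^2 = 1 / (2 * (β - 3)) := by
    rw [div_pow, Real.sq_sqrt hpos.le, one_pow]
  ext p
  simp only [Set.mem_ofPred_eq, fderiv_fMM_eq_zero_iff]
  constructor
  · rintro ⟨hf, hg⟩
    obtain ⟨h0, h1, h2⟩ := sq_eq_of_singular hβ hf (hg 0) (hg 1) (hg 2)
    have key (t : ℝ) (ht : 2 * (β - 3) * t^2 = 1) :
        ∃ ε : ℝ, (ε = 1 ∨ ε = -1) ∧ t = ε * (1 / Real.sqrt (2 * (β - 3))) := by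
      have : t^2 = (1 / Real.sqrt (2 * (β - 3)))^2 := by
        rw [hsq, eq_div_iff hpos.ne', mul_comm, ht]
      rcases sq_eq_sq_iff_eq_or_eq_neg.mp this with h | h
      · exact ⟨1, .inl rfl, by rw [h, one_mul]⟩
      · exact ⟨-1, .inr rfl, by rw [h, neg_one_mul]⟩
    obtain ⟨ε₁, hε₁, e₁⟩ := key _ h0
    obtain ⟨ε₂, hε₂, e₂⟩ := key _ h1
    obtain ⟨ε₃, hε₃, e₃⟩ := key _ h2
    exact ⟨ε₁, ε₂, ε₃, hε₁, hε₂, hε₃, e₁, e₂, e₃⟩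
  · rintro ⟨ε₁, ε₂, ε₃, hε₁, hε₂, hε₃, e₁, e₂, e₃⟩
    have key (ε t : ℝ) (hε : ε = 1 ∨ ε = -1)
        (ht : t = ε * (1 / Real.sqrt (2 * (β - 3)))) : t^2 = 1 / (2 * (β - 3)) := by
      rw [ht, mul_pow, hsq, sq_eq_one_iff.mpr hε, one_mul]
    have h0 := key _ _ hε₁ e₁
    have h1 := key _ _ hε₂ e₂
    have h2 := key _ _ hε₃ e₃
    have hne : β - 3 ≠ 0 := by linarith
    constructor
    · rw [fMM, h0, h1, h2, ← neg_sub β 3]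
      field_simp
      ring
    · intro i
      right
      have hi : (p i)^2 = 1 / (2 * (β - 3)) := by fin_cases i <;> assumption
      rw [hi, h0, h1, h2]
      field_simp
      ring
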